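/- Let 3 ≤ p ≤ q be positive integers. The graph K_{p,q}^+ fails to be determined by its spectrum if and only if the quadratic polynomial x² − (q+3)x + (pq+2) has two integer roots p'' ≤ q'' with p'' ≥ 2. -/

import Mathlib

open SimpleGraph Polynomial Matrix

universe u

/-- The graph `K_{p,q}⁻`, obtained from the complete bipartite graph `K_{p,q}`
by deleting one edge (the edge between the first vertex of each part). -/
def KpqMinus (p q : ℕ) : SimpleGraph (Fin p ⊕ Fin q) :=
  SimpleGraph.fromRel fun u v =>
    ∃ (i : Fin p) (j : Fin q), u = Sum.inl i ∧ v = Sum.inr j ∧ ¬(i.val = 0 ∧ j.val = 0)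

/-- The graph `K_{p,q}⁺`, obtained from the complete bipartite graph `K_{p,q}`
by adding a new vertex `x` together with a new edge `xy`, where `y` is a vertex
in the partite set of order `p`. -/
def KpqPlus (p q : ℕ) : SimpleGraph ((Fin p ⊕ Fin q) ⊕ Unit) :=
  SimpleGraph.fromRel fun u v =>
    (∃ (i : Fin p) (j : Fin q), u = Sum.inl (Sum.inl i) ∧ v = Sum.inl (Sum.inr j)) ∨
    (∃ i : Fin p, i.val = 0 ∧ u = Sum.inl (Sum.inl i) ∧ v = Sum.inr ())

/-- The disjoint union of a graph `G` with `m` isolated vertices. -/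
def addIsolated {V : Type*} (G : SimpleGraph V) (m : ℕ) : SimpleGraph (V ⊕ Fin m) :=
  SimpleGraph.fromRel fun u v => ∃ a b, u = Sum.inl a ∧ v = Sum.inl b ∧ G.Adj a b

open scoped Classical in
/-- The real adjacency matrix of a finite simple graph. -/
noncomputable def adjMat {V : Type*} [Fintype V] [DecidableEq V] (G : SimpleGraph V) :
    Matrix V V ℝ :=
  Matrix.of fun i j => if G.Adj i j then (1 : ℝ) else 0

/-- Two finite simple graphs are cospectral if their adjacency matrices have the same
characteristic polynomial. -/
def Cospectral {V W : Type*} [Fintype V] [DecidableEq V] [Fintype W] [DecidableEq W]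
    (G : SimpleGraph V) (H : SimpleGraph W) : Prop :=
  (adjMat G).charpoly = (adjMat H).charpoly

/-- A finite simple graph is determined by its spectrum (DS) if every graph cospectral
with it is isomorphic to it. -/
def IsDS {V : Type*} [Fintype V] [DecidableEq V] (G : SimpleGraph V) : Prop :=
  ∀ (W : Type u) [Fintype W] [DecidableEq W] (H : SimpleGraph W),
    Cospectral G H → Nonempty (G ≃g H)

/-- The spectral radius of a finite simple graph: the largest eigenvalue of its
adjacency matrix. -/
noncomputable def specRadius {V : Type*} [Fintype V] [DecidableEq V]
    (G : SimpleGraph V) : ℝ :=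
  sSup {x : ℝ | ∃ v : V → ℝ, v ≠ 0 ∧ (adjMat G).mulVec v = x • v}

/-- A graph is bipartite if its vertex set can be partitioned into two parts such that
every edge joins a vertex of one part to a vertex of the other. -/
def IsBipartite {V : Type*} (G : SimpleGraph V) : Prop :=
  ∃ s : Set V, ∀ a b, G.Adj a b → (a ∈ s ∧ b ∉ s) ∨ (a ∉ s ∧ b ∈ s)

/-! ### Spectral invariants of cospectral graphs -/

lemma adjMat_isHermitian {V : Type*} [Fintype V] [DecidableEq V] (G : SimpleGraph V) :
    (adjMat G).IsHermitian := by
  ext i j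
  by_cases h : G.Adj i j <;> simp [adjMat, h, G.adj_comm j i]

lemma Matrix.IsHermitian.trace_pow_eq_sum_roots {n : Type*} [Fintype n] [DecidableEq n]
    {A : Matrix n n ℝ} (hA : A.IsHermitian) (k : ℕ) :
    (A ^ k).trace = (A.charpoly.roots.map (· ^ k)).sum := by
  rw [hA.roots_charpoly_eq_eigenvalues, Multiset.map_map]
  conv_lhs => rw [hA.spectral_theorem, ← map_pow, Matrix.diagonal_pow,
    Unitary.conjStarAlgAut_apply, Matrix.trace_mul_comm, ← mul_assoc]
  simp [Matrix.trace_diagonal]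

lemma Cospectral.card_eq {V W : Type*} [Fintype V] [DecidableEq V] [Fintype W] [DecidableEq W]
    {G : SimpleGraph V} {H : SimpleGraph W} (h : Cospectral G H) :
    Fintype.card V = Fintype.card W := by
  have := congrArg Polynomial.natDegree h
  simpa [Matrix.charpoly_natDegree_eq_dim] using this

lemma rank_adjMat {V : Type*} [Fintype V] [DecidableEq V] (G : SimpleGraph V) :
    (adjMat G).rank = ((adjMat G).charpoly.roots.filter (· ≠ 0)).card := by
  rw [(adjMat_isHermitian G).rank_eq_card_non_zero_eigs,
    (adjMat_isHermitian G).roots_charpoly_eq_eigenvalues, Multiset.filter_map,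
    Multiset.card_map, Fintype.card_subtype]
  rfl

lemma Cospectral.rank_eq {V W : Type*} [Fintype V] [DecidableEq V] [Fintype W] [DecidableEq W]
    {G : SimpleGraph V} {H : SimpleGraph W} (h : Cospectral G H) :
    (adjMat G).rank = (adjMat H).rank := by
  rw [rank_adjMat, rank_adjMat, show (adjMat G).charpoly = (adjMat H).charpoly from h]

lemma trace_adjMat_pow_eq_zero_iff {V : Type*} [Fintype V] [DecidableEq V]
    (G : SimpleGraph V) (k : ℕ) :
    (adjMat G ^ k).trace = 0 ↔ ∀ u, ∀ w : G.Walk u u, w.length ≠ k := by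
  classical
  have h : adjMat G = G.adjMatrix ℝ := by
    ext i j
    simp [adjMat, SimpleGraph.adjMatrix_apply]
  rw [h, Matrix.trace, Finset.sum_eq_zero_iff_of_nonneg]
  · simp only [Finset.mem_univ, true_imp_iff, Matrix.diag_apply,
      SimpleGraph.adjMatrix_pow_apply_eq_card_walk, Nat.cast_eq_zero, Fintype.card_eq_zero_iff,
      Set.isEmpty_coe_sort, Set.eq_empty_iff_forall_notMem, Set.mem_ofPred_eq, ne_eq]
  · intro i _
    simp [SimpleGraph.adjMatrix_pow_apply_eq_card_walk]

lemma Cospectral.colorable_two {V W : Type*} [Fintype V] [DecidableEq V] [Fintype W]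
    [DecidableEq W] {G : SimpleGraph V} {H : SimpleGraph W} (h : Cospectral G H)
    (hG : G.Colorable 2) : H.Colorable 2 := by
  rw [two_colorable_iff_forall_loop_even] at hG ⊢
  intro u w
  by_contra hodd
  have h0 : (adjMat G ^ w.length).trace = 0 :=
    (trace_adjMat_pow_eq_zero_iff G _).2 fun v w' hw' => hodd (hw' ▸ hG v w')
  rw [(adjMat_isHermitian G).trace_pow_eq_sum_roots,
    show (adjMat G).charpoly = (adjMat H).charpoly from h,
    ← (adjMat_isHermitian H).trace_pow_eq_sum_roots, trace_adjMat_pow_eq_zero_iff] at h0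
  exact h0 u w rfl

/-! ### Blow-ups of a path -/

/-- Adjacency in the disjoint union of the path `0 - 1 - 2 - 3 - 4` and the isolated vertex `5`. -/
def pathRel (i j : Fin 6) : Prop :=
  (i.val + 1 = j.val ∧ j.val < 5) ∨ (j.val + 1 = i.val ∧ i.val < 5)

instance : DecidableRel pathRel := fun i j => by unfold pathRel; infer_instance

/-- The graph `G` is obtained from the path `0 - 1 - 2 - 3 - 4` together with the isolated vertex
`5` by replacing each vertex `i` with the independent set `f ⁻¹' {i}`. -/
def IsPathBlowup {V : Type*} (G : SimpleGraph V) (f : V → Fin 6) : Prop :=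
  ∀ u v, G.Adj u v ↔ pathRel (f u) (f v)

/-- The number of vertices in the class `i` of a blow-up. -/
def fiberCard {V : Type*} [Fintype V] (f : V → Fin 6) (i : Fin 6) : ℕ :=
  Fintype.card {v // f v = i}

/-- The adjacency matrix of the disjoint union of a path on five vertices and a vertex. -/
def pathMat : Matrix (Fin 6) (Fin 6) ℝ := Matrix.of fun i j => if pathRel i j then 1 else 0

/-- The incidence matrix of the classes of a blow-up. -/
def classMat {V : Type*} (f : V → Fin 6) : Matrix V (Fin 6) ℝ :=
  Matrix.of fun v i => if f v = i then 1 else 0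

lemma IsPathBlowup.adjMat_eq {V : Type*} [Fintype V] [DecidableEq V] {G : SimpleGraph V}
    {f : V → Fin 6} (h : IsPathBlowup G f) :
    adjMat G = classMat f * (pathMat * (classMat f)ᵀ) := by
  ext u v
  rw [Matrix.mul_apply, Finset.sum_eq_single (f u), Matrix.mul_apply, Finset.sum_eq_single (f v)]
  · simp [adjMat, classMat, pathMat, h u v]
  · intro j _ hj
    simp [classMat, hj.symm]
  · simp
  · intro j _ hj
    simp [classMat, hj.symm]
  · simp

lemma classMat_transpose_mul {V : Type*} [Fintype V] (f : V → Fin 6) :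
    (classMat f)ᵀ * classMat f = Matrix.diagonal fun i => (fiberCard f i : ℝ) := by
  ext i j
  rcases eq_or_ne i j with rfl | hij
  · simp [classMat, Matrix.mul_apply, fiberCard, Fintype.card_subtype, ← ite_and]
  · rw [Matrix.diagonal_apply_ne _ hij, Matrix.mul_apply]
    refine Finset.sum_eq_zero fun v _ => ?_
    by_cases hv : f v = i <;> simp [classMat, hv, hij]

lemma charpoly_pathMat_mul_diagonal (n : Fin 6 → ℝ) :
    (pathMat * Matrix.diagonal n).charpoly =
      X ^ 2 * (X ^ 4 - C (n 0 * n 1 + n 1 * n 2 + n 2 * n 3 + n 3 * n 4) * X ^ 2 +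
        C (n 1 * n 3 * (n 0 * n 2 + n 0 * n 4 + n 2 * n 4))) := by
  have h : (pathMat * Matrix.diagonal n).charmatrix =
      !![X, -C (n 1), 0, 0, 0, 0; -C (n 0), X, -C (n 2), 0, 0, 0; 0, -C (n 1), X, -C (n 3), 0, 0;
        0, 0, -C (n 2), X, -C (n 4), 0; 0, 0, 0, -C (n 3), X, 0; 0, 0, 0, 0, 0, X] := by
    ext1 i j
    fin_cases i <;> fin_cases j <;>
      simp [pathMat, pathRel]
  rw [Matrix.charpoly, h]
  simp [Matrix.det_succ_row_zero, Fin.sum_univ_succ, Fin.succAbove]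
  ring

lemma IsPathBlowup.charpoly {V : Type*} [Fintype V] [DecidableEq V] {G : SimpleGraph V}
    {f : V → Fin 6} (h : IsPathBlowup G f) :
    X ^ 4 * (adjMat G).charpoly = X ^ Fintype.card V *
      (X ^ 4 - C (fiberCard f 0 * fiberCard f 1 + fiberCard f 1 * fiberCard f 2 +
          fiberCard f 2 * fiberCard f 3 + fiberCard f 3 * fiberCard f 4 : ℝ) * X ^ 2 +
        C (fiberCard f 1 * fiberCard f 3 * (fiberCard f 0 * fiberCard f 2 +
          fiberCard f 0 * fiberCard f 4 + fiberCard f 2 * fiberCard f 4) : ℝ)) := by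
  have h1 : pathMat * (classMat f)ᵀ * classMat f =
      pathMat * Matrix.diagonal fun i => (fiberCard f i : ℝ) := by
    rw [Matrix.mul_assoc, classMat_transpose_mul]
  have h2 := congrArg Matrix.charpoly h1
  have h3 := Matrix.charpoly_mul_comm' (classMat f) (pathMat * (classMat f)ᵀ)
  rw [charpoly_pathMat_mul_diagonal] at h2
  simp only [← h.adjMat_eq, h2, Fintype.card_fin] at h3
  have hX : (X : ℝ[X]) ^ 2 ≠ 0 := pow_ne_zero _ X_ne_zero
  apply mul_left_cancel₀ hX
  rw [mul_left_comm _ (X ^ Fintype.card V), ← h3, ← mul_assoc, ← pow_add]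

lemma IsPathBlowup.rank_le {V : Type*} [Fintype V] [DecidableEq V] {G : SimpleGraph V}
    {f : V → Fin 6} (h : IsPathBlowup G f) : (adjMat G).rank ≤ 4 := by
  have hch := h.charpoly
  set Q : ℝ[X] := X ^ 4 - C (fiberCard f 0 * fiberCard f 1 + fiberCard f 1 * fiberCard f 2 +
      fiberCard f 2 * fiberCard f 3 + fiberCard f 3 * fiberCard f 4 : ℝ) * X ^ 2 +
    C (fiberCard f 1 * fiberCard f 3 * (fiberCard f 0 * fiberCard f 2 +
      fiberCard f 0 * fiberCard f 4 + fiberCard f 2 * fiberCard f 4) : ℝ) with hQ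
  have hdeg : Q.natDegree = 4 := by rw [hQ]; compute_degree!
  have hQ0 : Q ≠ 0 := by
    intro h0
    simp [h0] at hdeg
  have hX (k : ℕ) : (X : ℝ[X]) ^ k ≠ 0 := pow_ne_zero _ X_ne_zero
  have hroots := congrArg (fun P : ℝ[X] => (P.roots.filter (· ≠ 0)).card) hch
  simp only [roots_mul (mul_ne_zero (hX _) (adjMat G).charpoly_monic.ne_zero),
    roots_mul (mul_ne_zero (hX _) hQ0), Multiset.filter_add, roots_X_pow,
    Multiset.filter_nsmul, Multiset.filter_singleton, ne_eq, not_true_eq_false, if_false,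
    Multiset.empty_eq_zero, smul_zero, zero_add] at hroots
  rw [rank_adjMat]
  refine hroots.le.trans ((Multiset.card_le_card (Multiset.filter_le _ _)).trans ?_)
  exact (card_roots' Q).trans hdeg.le

/-- The number of edges of a blow-up with classes of the sizes `n`. -/
def blowupEdges (n : Fin 6 → ℕ) : ℕ := n 0 * n 1 + n 1 * n 2 + n 2 * n 3 + n 3 * n 4

/-- The number of four-element vertex sets that induce a subgraph with non-singular adjacency
matrix in a blow-up with classes of the sizes `n`. -/
def blowupMinors (n : Fin 6 → ℕ) : ℕ := n 1 * n 3 * (n 0 * n 2 + n 0 * n 4 + n 2 * n 4)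

lemma IsPathBlowup.cospectral_iff {V W : Type*} [Fintype V] [DecidableEq V] [Fintype W]
    [DecidableEq W] {G : SimpleGraph V} {H : SimpleGraph W} {f : V → Fin 6} {g : W → Fin 6}
    (hf : IsPathBlowup G f) (hg : IsPathBlowup H g) (hc : Fintype.card V = Fintype.card W) :
    Cospectral G H ↔ blowupEdges (fiberCard f) = blowupEdges (fiberCard g) ∧
      blowupMinors (fiberCard f) = blowupMinors (fiberCard g) := by
  have hX (k : ℕ) : (X : ℝ[X]) ^ k ≠ 0 := pow_ne_zero _ X_ne_zero
  have quartic (a b a' b' : ℝ) : (X ^ 4 - C a * X ^ 2 + C b : ℝ[X]) = X ^ 4 - C a' * X ^ 2 + C b' ↔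
      a = a' ∧ b = b' := by
    refine ⟨fun h => ⟨?_, ?_⟩, fun ⟨h, h'⟩ => by rw [h, h']⟩
    · simpa [coeff_X_pow, coeff_C] using congrArg (coeff · 2) h
    · simpa [coeff_X_pow, coeff_C] using congrArg (coeff · 0) h
  rw [Cospectral, ← mul_right_inj' (hX 4), hf.charpoly, hg.charpoly, hc, mul_right_inj' (hX _),
    quartic]
  unfold blowupEdges blowupMinors
  norm_cast

lemma sum_fiberCard {V : Type*} [Fintype V] (f : V → Fin 6) :
    ∑ i, fiberCard f i = Fintype.card V := by
  simp only [fiberCard]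
  rw [← Fintype.card_sigma]
  exact Fintype.card_congr (Equiv.sigmaFiberEquiv f)

lemma IsPathBlowup.nonempty_iso {V W : Type*} [Fintype V] [Fintype W] {G : SimpleGraph V}
    {H : SimpleGraph W} {f : V → Fin 6} {g : W → Fin 6} (hf : IsPathBlowup G f)
    (hg : IsPathBlowup H g) (h : ∀ i, fiberCard f i = fiberCard g i) : Nonempty (G ≃g H) := by
  have e : ∀ i, {v // f v = i} ≃ {w // g w = i} := fun i => Fintype.equivOfCardEq (h i)
  have key : ∀ v, g (e (f v) ⟨v, rfl⟩).1 = f v := fun v => (e (f v) ⟨v, rfl⟩).2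
  refine ⟨⟨(Equiv.sigmaFiberEquiv f).symm.trans ((Equiv.sigmaCongrRight e).trans
    (Equiv.sigmaFiberEquiv g)), ?_⟩⟩
  intro u v
  rw [hf, hg]
  change pathRel (g (e (f u) ⟨u, rfl⟩).1) (g (e (f v) ⟨v, rfl⟩).1) ↔ _
  rw [key, key]

lemma fiberCard_comp_perm {V : Type*} [Fintype V] (f : V → Fin 6) (σ : Equiv.Perm (Fin 6))
    (i : Fin 6) : fiberCard (σ ∘ f) i = fiberCard f (σ.symm i) := by
  simp only [fiberCard, Function.comp_apply, ← Equiv.eq_symm_apply]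

lemma IsPathBlowup.comp_perm {V : Type*} [Fintype V] {G : SimpleGraph V} {f : V → Fin 6}
    (h : IsPathBlowup G f) (σ : Equiv.Perm (Fin 6))
    (hσ : ∀ i j, fiberCard f i ≠ 0 → fiberCard f j ≠ 0 → (pathRel (σ i) (σ j) ↔ pathRel i j)) :
    IsPathBlowup G (σ ∘ f) := by
  intro u v
  have hne : ∀ w, fiberCard f (f w) ≠ 0 := fun w =>
    (Fintype.card_pos_iff.2 ⟨⟨w, rfl⟩⟩).ne'
  rw [h, Function.comp_apply, Function.comp_apply, hσ _ _ (hne u) (hne v)]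

/-! ### Bipartite graphs of rank at most four -/

lemma det_eq_zero_of_rank_adjMat_le {W : Type*} [Fintype W] [DecidableEq W] {H : SimpleGraph W}
    (hr : (adjMat H).rank ≤ 4) {S : W → Prop} (hS : ∀ u v, H.Adj u v → (S u ↔ ¬ S v))
    {s t : Fin 3 → W} (hs : ∀ i, S (s i)) (ht : ∀ i, ¬ S (t i)) :
    (Matrix.of fun i j => adjMat H (s i) (t j)).det = 0 := by
  set M : Matrix (Fin 3) (Fin 3) ℝ := Matrix.of fun i j => adjMat H (s i) (t j) with hM
  by_contra hdet
  have hsub : (adjMat H).submatrix (Sum.elim s t) (Sum.elim s t) =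
      Matrix.fromBlocks 0 M Mᵀ 0 := by
    ext i j
    rcases i with i | i <;> rcases j with j | j
    · have : ¬ H.Adj (s i) (s j) := fun h => (hS _ _ h).1 (hs i) (hs j)
      simp [adjMat, this]
    · simp [hM]
    · by_cases h : H.Adj (t i) (s j) <;> simp [hM, adjMat, h, H.adj_comm (s j) (t i)]
    · have : ¬ H.Adj (t i) (t j) := fun h => ht i ((hS _ _ h).2 (ht j))
      simp [adjMat, this]
  have hle := Matrix.rank_submatrix_le (adjMat H) (Sum.elim s t) (Sum.elim s t)
  have hunit : IsUnit (Matrix.fromBlocks 0 M Mᵀ 0) := by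
    have hM1 : IsUnit M.det := isUnit_iff_ne_zero.2 hdet
    have hM2 : IsUnit Mᵀ.det := by rwa [Matrix.det_transpose]
    refine IsUnit.of_mul_eq_one (Matrix.fromBlocks 0 (Mᵀ)⁻¹ M⁻¹ 0) ?_
    simp [Matrix.fromBlocks_multiply, Matrix.mul_nonsing_inv _ hM1, Matrix.mul_nonsing_inv _ hM2]
  rw [hsub, Matrix.rank_of_isUnit _ hunit, Fintype.card_sum, Fintype.card_fin] at hle
  omega

lemma exists_isPathBlowup_of_rows {W : Type*} {H : SimpleGraph W} {S : W → Prop}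
    (hS : ∀ u v, H.Adj u v → (S u ↔ ¬ S v)) {P Q : Finset (Fin 6)}
    (hP : ∀ a ∈ P, ∀ b ∈ P, ¬ pathRel a b) (hQ : ∀ a ∈ Q, ∀ b ∈ Q, ¬ pathRel a b)
    {κ : W → Fin 6} (hκ : ∀ t, κ t ∈ Q)
    (h : ∀ s, S s → ∃ a ∈ P, ∀ t, ¬ S t → (H.Adj s t ↔ pathRel a (κ t))) :
    ∃ f, IsPathBlowup H f := by
  classical
  choose! ρ hρ hadj using h
  have symm : ∀ a b, pathRel a b ↔ pathRel b a := by decide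
  refine ⟨fun w => if S w then ρ w else κ w, fun u v => ?_⟩
  by_cases hu : S u <;> by_cases hv : S v
  · simp only [hu, hv, if_true, hP _ (hρ u hu) _ (hρ v hv), iff_false]
    exact fun h => (hS _ _ h).1 hu hv
  · simp only [hu, hv, if_true, if_false, hadj u hu v hv]
  · simp only [hu, hv, if_true, if_false]
    rw [H.adj_comm, hadj v hv u hu, symm]
  · simp only [hu, hv, if_false, hQ _ (hκ u) _ (hκ v), iff_false]
    exact fun h => hu ((hS _ _ h).2 hv)

lemma exists_isPathBlowup_of_disjoint {W : Type*} {H : SimpleGraph W} {S : W → Prop}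
    (hS : ∀ u v, H.Adj u v → (S u ↔ ¬ S v)) {A B : W → Prop} (hAB : ∀ t, A t → ¬ B t)
    (h : ∀ s, S s → (∀ t, ¬ H.Adj s t) ∨ (∀ t, H.Adj s t ↔ A t) ∨ (∀ t, H.Adj s t ↔ B t) ∨
      ∀ t, H.Adj s t ↔ A t ∨ B t) :
    ∃ f, IsPathBlowup H f := by
  classical
  refine exists_isPathBlowup_of_rows hS (P := {0, 2, 4, 5}) (Q := {1, 3, 5}) (by decide)
    (by decide) (κ := fun t => if A t then 1 else if B t then 3 else 5) ?_ ?_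
  · intro t
    split_ifs <;> decide
  · intro s hs
    rcases h s hs with h | h | h | h
    · refine ⟨5, by decide, fun t _ => ?_⟩
      by_cases hA : A t <;> by_cases hB : B t <;> simp [hA, hB, h, pathRel]
    · refine ⟨0, by decide, fun t _ => ?_⟩
      by_cases hA : A t <;> by_cases hB : B t <;> simp [hA, hB, h, pathRel]
    · refine ⟨4, by decide, fun t _ => ?_⟩
      have := hAB t
      by_cases hA : A t <;> by_cases hB : B t <;> simp_all [pathRel]
    · refine ⟨2, by decide, fun t _ => ?_⟩
      by_cases hA : A t <;> by_cases hB : B t <;> simp [hA, hB, h, pathRel]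

lemma exists_isPathBlowup_of_two_rows {W : Type*} {H : SimpleGraph W} {S : W → Prop}
    (hS : ∀ u v, H.Adj u v → (S u ↔ ¬ S v)) {A B : W → Prop}
    (h : ∀ s, S s → (∀ t, ¬ H.Adj s t) ∨ (∀ t, H.Adj s t ↔ A t) ∨ ∀ t, H.Adj s t ↔ B t) :
    ∃ f, IsPathBlowup H f := by
  classical
  refine exists_isPathBlowup_of_rows hS (P := {1, 3, 5}) (Q := {0, 2, 4, 5}) (by decide)
    (by decide) (κ := fun t => if A t then if B t then 2 else 0 else if B t then 4 else 5) ?_ ?_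
  · intro t
    split_ifs <;> decide
  · intro s hs
    rcases h s hs with h | h | h
    · refine ⟨5, by decide, fun t _ => ?_⟩
      by_cases hA : A t <;> by_cases hB : B t <;> simp [hA, hB, h, pathRel]
    · refine ⟨1, by decide, fun t _ => ?_⟩
      by_cases hA : A t <;> by_cases hB : B t <;> simp [hA, hB, h, pathRel]
    · refine ⟨3, by decide, fun t _ => ?_⟩
      by_cases hA : A t <;> by_cases hB : B t <;> simp [hA, hB, h, pathRel]

lemma exists_isPathBlowup {W : Type*} [Fintype W] [DecidableEq W] {H : SimpleGraph W}
    (hr : (adjMat H).rank ≤ 4) (hcol : H.Colorable 2) : ∃ f, IsPathBlowup H f := by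
  obtain ⟨c⟩ := hcol
  obtain ⟨S, hS⟩ : ∃ S : W → Prop, ∀ u v, H.Adj u v → (S u ↔ ¬ S v) := by
    refine ⟨fun w => c w = 0, fun u v huv => ?_⟩
    have := c.valid huv
    dsimp only
    omega
  have hdet : ∀ s₁ s₂ s₃ t₁ t₂ t₃, S s₁ → S s₂ → S s₃ → ¬ S t₁ → ¬ S t₂ → ¬ S t₃ →
      (Matrix.of fun i j => adjMat H (![s₁, s₂, s₃] i) (![t₁, t₂, t₃] j)).det = 0 := by
    intro s₁ s₂ s₃ t₁ t₂ t₃ h₁ h₂ h₃ k₁ k₂ k₃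
    refine det_eq_zero_of_rank_adjMat_le hr hS (fun i => ?_) (fun i => ?_) <;>
      fin_cases i <;> assumption
  simp only [Matrix.det_fin_three, Matrix.of_apply, Matrix.cons_val, adjMat] at hdet
  have hT : ∀ {s t}, S s → H.Adj s t → ¬ S t := fun hs hst => (hS _ _ hst).1 hs
  by_cases hrows : ∀ s₁ s₂ t₁ t₂, S s₁ → S s₂ → H.Adj s₁ t₁ → H.Adj s₂ t₂ →
      ∀ t, H.Adj s₁ t → H.Adj s₂ t
  · refine exists_isPathBlowup_of_two_rows hS (A := fun t => ∃ s, S s ∧ H.Adj s t)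
      (B := fun _ => False) fun s hs => ?_
    by_cases h : ∃ t, H.Adj s t
    · obtain ⟨t₁, ht₁⟩ := h
      exact Or.inr (Or.inl fun t => ⟨fun h => ⟨s, hs, h⟩,
        fun ⟨s', hs', h⟩ => hrows s' s t t₁ hs' hs h ht₁ t h⟩)
    · exact Or.inl (not_exists.1 h)
  push Not at hrows
  obtain ⟨s₁, s₂, -, t₂, hs₁, hs₂, -, h₂, t₁, h₁₁, h₂₁⟩ := hrows
  have key : ∀ s, S s → ∀ t₁ t₂ t, ¬ S t₁ → ¬ S t₂ →
      (Matrix.of fun i j => adjMat H (![s₁, s₂, s] i) (![t₁, t₂, t] j)).det = 0 := by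
    intro s hs t₁ t₂ t k₁ k₂
    by_cases ht : S t
    · have : ∀ s, S s → ¬ H.Adj s t := fun s hs h => hT hs h ht
      simp [Matrix.det_fin_three, adjMat, this _ hs₁, this _ hs₂, this _ hs]
    · simpa only [Matrix.det_fin_three, Matrix.of_apply, Matrix.cons_val, adjMat] using
        hdet s₁ s₂ s t₁ t₂ t hs₁ hs₂ hs k₁ k₂ ht
  simp only [Matrix.det_fin_three, Matrix.of_apply, Matrix.cons_val, adjMat] at key
  have k₁ := hT hs₁ h₁₁
  by_cases hsub : ∃ t, H.Adj s₂ t ∧ ¬ H.Adj s₁ t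
  · obtain ⟨t₂, h₂₂, h₁₂⟩ := hsub
    have k₂ := hT hs₂ h₂₂
    by_cases hint : ∃ t, H.Adj s₁ t ∧ H.Adj s₂ t
    · obtain ⟨t₃, h₁₃, h₂₃⟩ := hint
      refine exists_isPathBlowup_of_two_rows hS (A := H.Adj s₁) (B := H.Adj s₂) fun s hs => ?_
      have hs' := fun t => key s hs t₁ t₂ t k₁ k₂
      have hs₃ := hs' t₃
      simp only [h₁₁, h₂₁, h₁₂, h₂₂, h₁₃, h₂₃, if_true, if_false] at hs' hs₃
      by_cases ha : H.Adj s t₁ <;> by_cases hb : H.Adj s t₂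
      · by_cases hc : H.Adj s t₃ <;> norm_num [ha, hb, hc] at hs₃
      · refine Or.inr (Or.inl fun t => ?_)
        have ht := hs' t
        revert ht
        by_cases hA : H.Adj s₁ t <;> by_cases hB : H.Adj s₂ t <;> by_cases hC : H.Adj s t <;>
          norm_num [ha, hb, hA, hB, hC]
      · refine Or.inr (Or.inr fun t => ?_)
        have ht := hs' t
        revert ht
        by_cases hA : H.Adj s₁ t <;> by_cases hB : H.Adj s₂ t <;> by_cases hC : H.Adj s t <;>
          norm_num [ha, hb, hA, hB, hC]
      · refine Or.inl fun t => ?_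
        have ht := hs' t
        revert ht
        by_cases hA : H.Adj s₁ t <;> by_cases hB : H.Adj s₂ t <;> by_cases hC : H.Adj s t <;>
          norm_num [ha, hb, hA, hB, hC]
    · have hAB : ∀ t, H.Adj s₁ t → ¬ H.Adj s₂ t := fun t h h' => hint ⟨t, h, h'⟩
      refine exists_isPathBlowup_of_disjoint hS hAB fun s hs => ?_
      have hs' := fun t => key s hs t₁ t₂ t k₁ k₂
      simp only [h₁₁, h₂₁, h₁₂, h₂₂, if_true, if_false] at hs'
      by_cases ha : H.Adj s t₁ <;> by_cases hb : H.Adj s t₂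
      · refine Or.inr (Or.inr (Or.inr fun t => ?_))
        have ht := hs' t
        have := hAB t
        revert ht this
        by_cases hA : H.Adj s₁ t <;> by_cases hB : H.Adj s₂ t <;> by_cases hC : H.Adj s t <;>
          norm_num [ha, hb, hA, hB, hC]
      · refine Or.inr (Or.inl fun t => ?_)
        have ht := hs' t
        revert ht
        by_cases hA : H.Adj s₁ t <;> by_cases hB : H.Adj s₂ t <;> by_cases hC : H.Adj s t <;>
          norm_num [ha, hb, hA, hB, hC]
      · refine Or.inr (Or.inr (Or.inl fun t => ?_))
        have ht := hs' t
        revert ht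
        by_cases hA : H.Adj s₁ t <;> by_cases hB : H.Adj s₂ t <;> by_cases hC : H.Adj s t <;>
          norm_num [ha, hb, hA, hB, hC]
      · refine Or.inl fun t => ?_
        have ht := hs' t
        revert ht
        by_cases hA : H.Adj s₁ t <;> by_cases hB : H.Adj s₂ t <;> by_cases hC : H.Adj s t <;>
          norm_num [ha, hb, hA, hB, hC]
  · have hsub' : ∀ t, H.Adj s₂ t → H.Adj s₁ t := by
      simpa only [not_exists, not_and, not_not] using hsub
    have h₁₂ := hsub' t₂ h₂
    have k₂ := hT hs₂ h₂
    refine exists_isPathBlowup_of_disjoint hS (A := H.Adj s₂)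
      (B := fun t => H.Adj s₁ t ∧ ¬ H.Adj s₂ t) (fun t h h' => h'.2 h) fun s hs => ?_
    have hs' := fun t => key s hs t₁ t₂ t k₁ k₂
    simp only [h₁₁, h₂₁, h₁₂, h₂, if_true, if_false] at hs'
    by_cases ha : H.Adj s t₁ <;> by_cases hb : H.Adj s t₂
    · refine Or.inr (Or.inr (Or.inr fun t => ?_))
      have ht := hs' t
      have := hsub' t
      revert ht this
      by_cases hA : H.Adj s₁ t <;> by_cases hB : H.Adj s₂ t <;> by_cases hC : H.Adj s t <;>
        norm_num [ha, hb, hA, hB, hC]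
    · refine Or.inr (Or.inr (Or.inl fun t => ?_))
      have ht := hs' t
      have := hsub' t
      revert ht this
      by_cases hA : H.Adj s₁ t <;> by_cases hB : H.Adj s₂ t <;> by_cases hC : H.Adj s t <;>
        norm_num [ha, hb, hA, hB, hC]
    · refine Or.inr (Or.inl fun t => ?_)
      have ht := hs' t
      have := hsub' t
      revert ht this
      by_cases hA : H.Adj s₁ t <;> by_cases hB : H.Adj s₂ t <;> by_cases hC : H.Adj s t <;>
        norm_num [ha, hb, hA, hB, hC]
    · refine Or.inl fun t => ?_
      have ht := hs' t
      have := hsub' t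
      revert ht this
      by_cases hA : H.Adj s₁ t <;> by_cases hB : H.Adj s₂ t <;> by_cases hC : H.Adj s t <;>
        norm_num [ha, hb, hA, hB, hC]

/-! ### The graphs `K_{p,q}⁺` -/

/-- The classes of `K_{p,q}⁺` as a blow-up of a path. -/
def KpqPlusClass (p q : ℕ) : (Fin p ⊕ Fin q) ⊕ Unit → Fin 6
  | Sum.inl (Sum.inl i) => if i.val = 0 then 2 else 0
  | Sum.inl (Sum.inr _) => 1
  | Sum.inr _ => 3

lemma isPathBlowup_KpqPlus (p q : ℕ) : IsPathBlowup (KpqPlus p q) (KpqPlusClass p q) := by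
  rintro ((i | i) | i) ((j | j) | j)
  · by_cases hi : i.val = 0 <;> by_cases hj : j.val = 0 <;>
      simp [KpqPlus, KpqPlusClass, pathRel, hi, hj]
  · by_cases hi : i.val = 0 <;> simp [KpqPlus, KpqPlusClass, pathRel, hi]
  · by_cases hi : i.val = 0 <;> simp [KpqPlus, KpqPlusClass, pathRel, hi]
  · by_cases hj : j.val = 0 <;> simp [KpqPlus, KpqPlusClass, pathRel, hj]
  · simp [KpqPlus, KpqPlusClass, pathRel]
  · simp [KpqPlus, KpqPlusClass, pathRel]
  · by_cases hj : j.val = 0 <;> simp [KpqPlus, KpqPlusClass, pathRel, hj]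
  · simp [KpqPlus, KpqPlusClass, pathRel]
  · simp [KpqPlus, KpqPlusClass, pathRel]

lemma fiberCard_KpqPlusClass (k q : ℕ) :
    fiberCard (KpqPlusClass (k + 1) q) = ![k, q, 1, 1, 0, 0] := by
  ext i
  rw [fiberCard, Fintype.card_subtype, Finset.card_filter, Fintype.sum_sum_type,
    Fintype.sum_sum_type, Fin.sum_univ_succ]
  fin_cases i <;> simp [KpqPlusClass]

lemma KpqPlus_colorable_two (p q : ℕ) : (KpqPlus p q).Colorable 2 := by
  refine ⟨Coloring.mk (fun v => if (KpqPlusClass p q v).val % 2 = 0 then 0 else 1) ?_⟩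
  intro u v huv
  rw [isPathBlowup_KpqPlus] at huv
  unfold pathRel at huv
  split_ifs <;> simp <;> omega

/-- A blow-up with the number of edges and minors of `K_{k+1,q}⁺` has an empty end class. -/
lemma end_class_eq_zero {n : Fin 6 → ℕ} {k q : ℕ} (hk : 0 < k) (hq : 0 < q)
    (he : blowupEdges n = (k + 1) * q + 1) (hm : blowupMinors n = k * q) :
    n 0 = 0 ∨ n 4 = 0 := by
  unfold blowupEdges at he
  unfold blowupMinors at hm
  by_contra! h
  obtain ⟨h0, h4⟩ := h
  have hpos : 0 < k * q := Nat.mul_pos hk hq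
  have h1 : n 1 ≠ 0 := fun h => by simp [h] at hm; omega
  have h3 : n 3 ≠ 0 := fun h => by simp [h] at hm; omega
  obtain ⟨a, ha⟩ := Nat.exists_eq_succ_of_ne_zero h0
  obtain ⟨b, hb⟩ := Nat.exists_eq_succ_of_ne_zero h4
  obtain ⟨s, hs⟩ := Nat.exists_eq_succ_of_ne_zero h1
  obtain ⟨t, ht⟩ := Nat.exists_eq_succ_of_ne_zero h3
  rw [ha, hb, hs, ht] at he hm
  generalize n 2 = c at he hm
  simp only [Nat.succ_eq_add_one] at he hm
  have hle : (a + 1) * (s + 1) + (s + 1) * c + c * (t + 1) + (t + 1) * (b + 1) ≤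
      (s + 1) * (t + 1) * ((a + 1) * c + (a + 1) * (b + 1) + c * (b + 1)) + 1 := by
    refine Nat.le.intro (k := a * b + a * c + b * c + s * (a * c + a * b + b + c * b + c) +
      t * (a * c + a * b + a + c * b + c) +
      s * t * ((a + 1) * c + (a + 1) * (b + 1) + c * (b + 1))) ?_
    ring
  nlinarith

/-- The solutions of the equations for the sizes of the classes of a blow-up of a path on four
vertices that is cospectral with `K_{k+1,q}⁺`. -/
lemma sizes_of_path_four {w x y z k q : ℕ} (hk : 0 < k) (hq : 2 ≤ q)
    (he : w * x + x * y + y * z = (k + 1) * q + 1) (hm : w * x * (y * z) = k * q) :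
    (w = k ∧ x = q ∧ y = 1 ∧ z = 1) ∨ (w = 1 ∧ x = 1 ∧ y = q ∧ z = k) ∨
      (w = 1 ∧ z = 1 ∧ x + y = q + 1 ∧ x * y = k * q) := by
  have hpos : 0 < w * x * (y * z) := hm ▸ Nat.mul_pos hk (by omega)
  have hw : 0 < w := Nat.pos_of_mul_pos_right (Nat.pos_of_mul_pos_right hpos)
  have hx : 0 < x := Nat.pos_of_mul_pos_left (Nat.pos_of_mul_pos_right hpos)
  have hy : 0 < y := Nat.pos_of_mul_pos_right (Nat.pos_of_mul_pos_left hpos)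
  have hz : 0 < z := Nat.pos_of_mul_pos_left (Nat.pos_of_mul_pos_left hpos)
  by_cases hyz : y * z = 1
  · obtain ⟨rfl, rfl⟩ := mul_eq_one.1 hyz
    left
    have hxq : x = q := by linarith
    subst hxq
    refine ⟨Nat.eq_of_mul_eq_mul_right hx (by linarith), rfl, rfl, rfl⟩
  by_cases hwx : w * x = 1
  · obtain ⟨rfl, rfl⟩ := mul_eq_one.1 hwx
    right; left
    have hyq : y = q := by linarith
    subst hyq
    refine ⟨rfl, rfl, rfl, Nat.eq_of_mul_eq_mul_left hy (by linarith)⟩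
  by_cases hwz : w * z = 1
  · obtain ⟨rfl, rfl⟩ := mul_eq_one.1 hwz
    right; right
    refine ⟨rfl, rfl, by linarith, by linarith⟩
  exfalso
  have h1 : 2 ≤ y * z := by have := Nat.mul_pos hy hz; omega
  have h2 : 2 ≤ w * x := by have := Nat.mul_pos hw hx; omega
  have h3 : 2 ≤ w * z := by have := Nat.mul_pos hw hz; omega
  have h4 : 2 * (x * y) ≤ w * x * (y * z) :=
    calc 2 * (x * y) ≤ w * z * (x * y) := Nat.mul_le_mul_right _ h3
      _ = w * x * (y * z) := by ring
  generalize w * x = m at *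
  generalize y * z = n at *
  generalize x * y = l at *
  nlinarith

lemma KpqPlus_exists_class {k q : ℕ} (hk : 0 < k) (hq : 0 < q) {W : Type*} [Fintype W]
    [DecidableEq W] {H : SimpleGraph W} (h : Cospectral (KpqPlus (k + 1) q) H) :
    ∃ f, IsPathBlowup H f ∧ fiberCard f 4 = 0 ∧
      blowupEdges (fiberCard f) = (k + 1) * q + 1 ∧ blowupMinors (fiberCard f) = k * q := by
  have hK := isPathBlowup_KpqPlus (k + 1) q
  obtain ⟨f, hf⟩ := exists_isPathBlowup (h.rank_eq ▸ hK.rank_le)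
    (h.colorable_two (KpqPlus_colorable_two _ _))
  obtain ⟨he, hm⟩ := (hK.cospectral_iff hf h.card_eq).1 h
  rw [fiberCard_KpqPlusClass] at he hm
  replace he : blowupEdges (fiberCard f) = (k + 1) * q + 1 := by
    rw [← he]; simp [blowupEdges]; ring
  replace hm : blowupMinors (fiberCard f) = k * q := by
    rw [← hm]; simp [blowupMinors]; ring
  rcases end_class_eq_zero hk hq he hm with h0 | h4
  · set σ : Equiv.Perm (Fin 6) := Equiv.swap 0 4 * Equiv.swap 1 3
    have hrel : ∀ i j, pathRel (σ i) (σ j) ↔ pathRel i j := by decide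
    have hσf : fiberCard (σ ∘ f) = fiberCard f ∘ σ.symm :=
      funext fun i => fiberCard_comp_perm f σ i
    refine ⟨σ ∘ f, hf.comp_perm σ fun i j _ _ => hrel i j, ?_, ?_, ?_⟩
    · rw [hσf, Function.comp_apply, show σ.symm 4 = 0 by decide, h0]
    · rw [hσf, ← he]
      simp only [blowupEdges, Function.comp_apply, show σ.symm 0 = 4 by decide,
        show σ.symm 1 = 3 by decide, show σ.symm 2 = 2 by decide, show σ.symm 3 = 1 by decide,
        show σ.symm 4 = 0 by decide]
      ring
    · rw [hσf, ← hm]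
      simp only [blowupMinors, Function.comp_apply, show σ.symm 0 = 4 by decide,
        show σ.symm 1 = 3 by decide, show σ.symm 2 = 2 by decide, show σ.symm 3 = 1 by decide,
        show σ.symm 4 = 0 by decide]
      ring
  · exact ⟨f, hf, h4, he, hm⟩

lemma KpqPlus_nonempty_iso {k q : ℕ} {W : Type*} [Fintype W] {H : SimpleGraph W}
    {f : W → Fin 6} (hf : IsPathBlowup H f) (hc : Fintype.card W = k + 1 + q + 1)
    (h0 : fiberCard f 0 = k) (h1 : fiberCard f 1 = q) (h2 : fiberCard f 2 = 1)
    (h3 : fiberCard f 3 = 1) (h4 : fiberCard f 4 = 0) : Nonempty (KpqPlus (k + 1) q ≃g H) := by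
  have h5 : fiberCard f 5 = 0 := by
    have := sum_fiberCard f
    simp only [Fin.sum_univ_six] at this
    omega
  refine (isPathBlowup_KpqPlus (k + 1) q).nonempty_iso hf fun i => ?_
  rw [fiberCard_KpqPlusClass]
  fin_cases i <;> simp [*]

lemma exists_sizes_of_not_isDS {k q : ℕ} (hk : 0 < k) (hq : 2 ≤ q)
    (h : ¬ IsDS.{u} (KpqPlus (k + 1) q)) :
    ∃ x y : ℕ, 0 < x ∧ 0 < y ∧ x + y = q + 1 ∧ x * y = k * q := by
  unfold IsDS at h
  push Not at h
  obtain ⟨W, _, _, H, hcos, hiso⟩ := h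
  rw [← not_nonempty_iff] at hiso
  obtain ⟨f, hf, h4, he, hm⟩ := KpqPlus_exists_class hk (by omega) hcos
  have hc : Fintype.card W = k + 1 + q + 1 := by rw [← hcos.card_eq]; simp
  simp only [blowupEdges, blowupMinors, h4, mul_zero, add_zero] at he hm
  rcases sizes_of_path_four hk hq he (by rw [← hm]; ring) with
    ⟨h0, h1, h2, h3⟩ | ⟨h0, h1, h2, h3⟩ | ⟨-, -, hadd, hmul⟩
  · exact absurd (KpqPlus_nonempty_iso hf hc h0 h1 h2 h3 h4) hiso
  · set σ : Equiv.Perm (Fin 6) := Equiv.swap 0 3 * Equiv.swap 1 2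
    have hσf : ∀ i j, σ.symm i = j → fiberCard (σ ∘ f) i = fiberCard f j := fun i j hij => by
      rw [fiberCard_comp_perm, hij]
    have hrel : ∀ i j, i ≠ 4 → j ≠ 4 → (pathRel (σ i) (σ j) ↔ pathRel i j) := by decide
    refine absurd (KpqPlus_nonempty_iso (hf.comp_perm σ fun i j hi hj => hrel i j ?_ ?_) hc
      ((hσf 0 3 (by decide)).trans h3) ((hσf 1 2 (by decide)).trans h2)
      ((hσf 2 1 (by decide)).trans h1) ((hσf 3 0 (by decide)).trans h0)
      ((hσf 4 4 (by decide)).trans h4)) hiso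
    · rintro rfl; exact hi h4
    · rintro rfl; exact hj h4
  · have hpos : 0 < fiberCard f 1 * fiberCard f 2 := hmul ▸ Nat.mul_pos hk (by omega)
    exact ⟨_, _, Nat.pos_of_mul_pos_right hpos, Nat.pos_of_mul_pos_left hpos, hadd, hmul⟩

/-- The graph obtained from the path `0 - 1 - 2 - 3 - 4` together with the isolated vertex `5` by
replacing each vertex `i` with `n i` independent vertices. -/
def pathBlowup (n : Fin 6 → ℕ) : SimpleGraph (ULift.{u} (Σ i, Fin (n i))) where
  Adj u v := pathRel u.down.1 v.down.1
  symm := ⟨fun _ _ h => Or.symm h⟩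
  loopless := ⟨fun u h => by unfold pathRel at h; omega⟩

lemma isPathBlowup_pathBlowup (n : Fin 6 → ℕ) :
    IsPathBlowup (pathBlowup.{u} n) fun v => v.down.1 := fun _ _ => Iff.rfl

lemma fiberCard_pathBlowup (n : Fin 6 → ℕ) :
    fiberCard (fun v : ULift.{u} (Σ i, Fin (n i)) => v.down.1) = n := by
  ext i
  have e : {v : ULift.{u} (Σ i, Fin (n i)) // v.down.1 = i} ≃ Fin (n i) :=
    (Equiv.ulift.subtypeEquiv fun _ => Iff.rfl).trans (Equiv.sigmaSubtype i)
  rw [fiberCard, Fintype.card_congr e, Fintype.card_fin]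

lemma KpqPlus_not_isDS_of_sizes {k q x y : ℕ} (hk : 2 ≤ k) (hq : 0 < q)
    (hadd : x + y = q + 1) (hmul : x * y = k * q) : ¬ IsDS.{u} (KpqPlus (k + 1) q) := by
  intro hDS
  have hK := isPathBlowup_KpqPlus (k + 1) q
  have hB := isPathBlowup_pathBlowup.{u} ![1, x, y, 1, 0, k - 1]
  have hcos : Cospectral (KpqPlus (k + 1) q) (pathBlowup.{u} ![1, x, y, 1, 0, k - 1]) := by
    refine (hK.cospectral_iff hB ?_).2 ?_
    · simp [Fin.sum_univ_six]
      omega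
    · rw [fiberCard_KpqPlusClass, fiberCard_pathBlowup]
      simp only [blowupEdges, blowupMinors, Matrix.cons_val]
      constructor <;> nlinarith
  obtain ⟨e⟩ := hDS _ _ hcos
  have hne : ∀ u, ∃ v, (KpqPlus (k + 1) q).Adj u v := by
    rintro ((i | i) | i)
    · exact ⟨Sum.inl (Sum.inr ⟨0, hq⟩), by simp [KpqPlus]⟩
    · exact ⟨Sum.inl (Sum.inl 0), by simp [KpqPlus]⟩
    · exact ⟨Sum.inl (Sum.inl 0), by simp [KpqPlus]⟩
  obtain ⟨v, hv⟩ := hne (e.symm ⟨⟨5, ⟨0, by simp; omega⟩⟩⟩)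
  rw [← e.map_adj_iff, e.apply_symm_apply, hB] at hv
  unfold pathRel at hv
  simp at hv
  omega

/-- For integers `3 ≤ p ≤ q`, the graph `K_{p,q}⁺` fails to be determined
by its spectrum iff `x² − (q+3)x + (pq+2)` has two integer roots `p'' ≤ q''` with
`p'' ≥ 2`. -/
theorem KpqPlus_not_isDS_iff (p q : ℕ) (hp : 3 ≤ p) (hpq : p ≤ q) :
    ¬ IsDS.{u} (KpqPlus p q) ↔
      ∃ p'' q'' : ℤ, 2 ≤ p'' ∧ p'' ≤ q'' ∧
        p'' ^ 2 - (q + 3) * p'' + (p * q + 2) = 0 ∧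
        q'' ^ 2 - (q + 3) * q'' + (p * q + 2) = 0 ∧
        p'' + q'' = q + 3 ∧ p'' * q'' = p * q + 2 := by
  obtain ⟨k, rfl⟩ : ∃ k, p = k + 1 := ⟨p - 1, by omega⟩
  constructor
  · intro h
    obtain ⟨x, y, hx, hy, hadd, hmul⟩ := exists_sizes_of_not_isDS (by omega) (by omega) h
    wlog hxy : x ≤ y generalizing x y
    · exact this y x hy hx (by omega) (by rw [mul_comm, hmul]) (by omega)
    have hadd' : (x : ℤ) + y = q + 1 := by exact_mod_cast hadd
    have hmul' : (x : ℤ) * y = k * q := by exact_mod_cast hmul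
    have hsum : (x + 1 : ℤ) + (y + 1) = q + 3 := by linarith
    have hprod : (x + 1 : ℤ) * (y + 1) = ((k + 1 : ℕ) : ℤ) * q + 2 := by
      push_cast
      linear_combination hadd' + hmul'
    refine ⟨x + 1, y + 1, by omega, by omega, ?_, ?_, hsum, hprod⟩
    · rw [← hsum, ← hprod]; ring
    · rw [← hsum, ← hprod]; ring
  · rintro ⟨p'', q'', h2, hle, -, -, hadd, hmul⟩
    obtain ⟨x, rfl⟩ : ∃ x : ℕ, p'' = x + 1 := ⟨(p'' - 1).toNat, by omega⟩
    obtain ⟨y, rfl⟩ : ∃ y : ℕ, q'' = y + 1 := ⟨(q'' - 1).toNat, by omega⟩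
    refine KpqPlus_not_isDS_of_sizes (x := x) (y := y) (by omega) (by omega) (by omega) ?_
    push_cast at hmul
    zify
    linear_combination hmul - hadd
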